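/- arXiv:1912.06917 — 2 statements merged into one kernel-verified Lean document; each statement's English description precedes it below -/
import Mathlib

section
/- Let M, N, N_d, K be positive integers, let V₁ ∈ ℂ^{MN_d×MN_d} and V₂ ∈ ℂ^{MK×MK} be unitary, let Ḡ ∈ ℂ^{MN×MK}, Q̄ ∈ ℂ^{MN_d×MN}, let Σ ∈ ℂ^{MN×MN} be Hermitian positive definite, and let σ_q > 0. Define f(A) = Re tr(I_{MK}) − Re tr(A V₁ Q̄ Ḡ V₂) − Re tr((V₁ Q̄ Ḡ V₂)ᴴ Aᴴ) + Re tr(A (σ_q² I_{MN_d} + V₁ Q̄ Σ Q̄ᴴ V₁ᴴ) Aᴴ), and let A* = V₂ᴴ Ḡᴴ Q̄ᴴ (σ_q² I_{MN_d} + Q̄ Σ Q̄ᴴ)^{-1} V₁ᴴ. Then the minimum value of f satisfies f(A*) = Re tr(I_{MK} − Ḡᴴ Σ^{-1} Ḡ) + Re tr(Ḡᴴ Σ^{-1} (Σ^{-1} + σ_q^{-2} Q̄ᴴ Q̄)^{-1} Σ^{-1} Ḡ). That is, the minimal MSE decomposes as the unquantized MMSE e^o = Re tr(I_{MK} − ḠᴴΣ^{-1}Ḡ)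 plus the excess MSE term EMSE(Q̄) = Re tr(Ḡᴴ Σ^{-1} (Σ^{-1} + σ_q^{-2} Q̄ᴴ Q̄)^{-1} Σ^{-1} Ḡ). -/
open Matrix
open scoped ComplexOrder

/-- Lemma 1 (second part) of the paper: the minimal MSE of the optimal digital filter
`A* = V₂ᴴ Ḡᴴ Q̄ᴴ (σ_q² I + Q̄ Σ Q̄ᴴ)⁻¹ V₁ᴴ` decomposes as the unquantized MMSE
`e^o = Re tr(I − Ḡᴴ Σ⁻¹ Ḡ)` plus the excess MSE
`EMSE(Q̄) = Re tr(Ḡᴴ Σ⁻¹ (Σ⁻¹ + σ_q⁻² Q̄ᴴ Q̄)⁻¹ Σ⁻¹ Ḡ)`. -/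
theorem stmt2 (M N N_d K : ℕ) (hM : 0 < M) (hN : 0 < N) (hNd : 0 < N_d) (hK : 0 < K)
    (V₁ : Matrix (Fin (M * N_d)) (Fin (M * N_d)) ℂ) (hV₁ : V₁ᴴ * V₁ = 1)
    (V₂ : Matrix (Fin (M * K)) (Fin (M * K)) ℂ) (hV₂ : V₂ᴴ * V₂ = 1)
    (G : Matrix (Fin (M * N)) (Fin (M * K)) ℂ)
    (Q : Matrix (Fin (M * N_d)) (Fin (M * N)) ℂ)
    (S : Matrix (Fin (M * N)) (Fin (M * N)) ℂ) (hS : S.PosDef)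
    (σq : ℝ) (hσ : 0 < σq)
    (f : Matrix (Fin (M * K)) (Fin (M * N_d)) ℂ → ℝ)
    (hf : ∀ A, f A = (Matrix.trace (1 : Matrix (Fin (M * K)) (Fin (M * K)) ℂ)).re
        - (Matrix.trace (A * (V₁ * Q * G * V₂))).re
        - (Matrix.trace ((V₁ * Q * G * V₂)ᴴ * Aᴴ)).re
        + (Matrix.trace (A * ((σq : ℂ) ^ 2 • 1 + V₁ * Q * S * Qᴴ * V₁ᴴ) * Aᴴ)).re) :
    f (V₂ᴴ * Gᴴ * Qᴴ * ((σq : ℂ) ^ 2 • 1 + Q * S * Qᴴ)⁻¹ * V₁ᴴ) =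
      (Matrix.trace ((1 : Matrix (Fin (M * K)) (Fin (M * K)) ℂ) - Gᴴ * S⁻¹ * G)).re
      + (Matrix.trace (Gᴴ * S⁻¹ * (S⁻¹ + ((σq : ℂ) ^ 2)⁻¹ • (Qᴴ * Q))⁻¹ * S⁻¹ * G)).re := by
  have hc : (0 : ℂ) < (σq : ℂ) ^ 2 := by
    have : (0 : ℂ) < (σq : ℂ) := by exact_mod_cast hσ
    exact pow_pos this 2
  have hc0 : (σq : ℂ) ^ 2 ≠ 0 := hc.ne'
  generalize (σq : ℂ) ^ 2 = c at *
  have hV₁' : V₁ * V₁ᴴ = 1 := mul_eq_one_comm.mp hV₁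
  have hV₂' : V₂ * V₂ᴴ = 1 := mul_eq_one_comm.mp hV₂
  have hB : (c • (1 : Matrix (Fin (M * N_d)) (Fin (M * N_d)) ℂ) + Q * S * Qᴴ).PosDef :=
    (Matrix.PosDef.one.smul hc).add_posSemidef (hS.posSemidef.mul_mul_conjTranspose_same Q)
  have hBu := (Matrix.isUnit_iff_isUnit_det _).mp hB.isUnit
  have hSu := (Matrix.isUnit_iff_isUnit_det _).mp hS.isUnit
  have hBT := Matrix.mul_nonsing_inv _ hBu
  have hTB := Matrix.nonsing_inv_mul _ hBu
  have hTH := hB.isHermitian.inv.eq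
  have hSS := Matrix.mul_nonsing_inv _ hSu
  have hSS' := Matrix.nonsing_inv_mul _ hSu
  have hB1 : c • (1 : Matrix (Fin (M * N_d)) (Fin (M * N_d)) ℂ) + V₁ * Q * S * Qᴴ * V₁ᴴ
      = V₁ * (c • 1 + Q * S * Qᴴ) * V₁ᴴ := by
    rw [Matrix.mul_add, Matrix.add_mul, Matrix.mul_smul, Matrix.smul_mul, Matrix.mul_one, hV₁']
    simp only [Matrix.mul_assoc]
  rw [hf, hB1]
  clear hB1 hf
  generalize hT : (c • (1 : Matrix (Fin (M * N_d)) (Fin (M * N_d)) ℂ) + Q * S * Qᴴ)⁻¹ = T at *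
  have hQT : Q * S * Qᴴ * T = 1 - c • T := by
    rw [← hBT, Matrix.add_mul, Matrix.smul_mul, Matrix.one_mul]; abel
  generalize c • (1 : Matrix (Fin (M * N_d)) (Fin (M * N_d)) ℂ) + Q * S * Qᴴ = B at *
  have hW : (S⁻¹ + c⁻¹ • (Qᴴ * Q))⁻¹ = S - S * Qᴴ * T * Q * S := by
    apply Matrix.inv_eq_right_inv
    have e1 : S⁻¹ * (S * Qᴴ * T * Q * S) = Qᴴ * T * Q * S := by
      simp only [← Matrix.mul_assoc, hSS', Matrix.one_mul]
    have e2 : Qᴴ * Q * (S * Qᴴ * T * Q * S) = Qᴴ * Q * S - c • (Qᴴ * T * Q * S) := by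
      have : Qᴴ * Q * (S * Qᴴ * T * Q * S) = Qᴴ * (Q * S * Qᴴ * T) * Q * S := by
        simp only [Matrix.mul_assoc]
      rw [this, hQT]
      simp only [Matrix.mul_sub, Matrix.sub_mul, Matrix.mul_one, Matrix.mul_smul, Matrix.smul_mul]
    rw [Matrix.add_mul, Matrix.mul_sub, Matrix.mul_sub, hSS', e1, Matrix.smul_mul,
      Matrix.smul_mul, e2, smul_sub, smul_smul, inv_mul_cancel₀ hc0, one_smul]
    abel
  have hX1 : Matrix.trace (V₂ᴴ * Gᴴ * Qᴴ * T * V₁ᴴ * (V₁ * Q * G * V₂))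
      = Matrix.trace (Gᴴ * Qᴴ * T * Q * G) := by
    have : V₂ᴴ * Gᴴ * Qᴴ * T * V₁ᴴ * (V₁ * Q * G * V₂)
        = V₂ᴴ * ((Gᴴ * Qᴴ * T * (V₁ᴴ * V₁) * Q * G) * V₂) := by
      simp only [Matrix.mul_assoc]
    rw [this, hV₁, Matrix.trace_mul_comm, Matrix.mul_assoc _ V₂, hV₂', Matrix.mul_one,
      Matrix.mul_one]
  have hX2 : Matrix.trace (V₂ᴴ * Gᴴ * Qᴴ * T * V₁ᴴ * (V₁ * B * V₁ᴴ)
        * (V₂ᴴ * Gᴴ * Qᴴ * T * V₁ᴴ)ᴴ) = Matrix.trace (Gᴴ * Qᴴ * T * Q * G) := by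
    have : V₂ᴴ * Gᴴ * Qᴴ * T * V₁ᴴ * (V₁ * B * V₁ᴴ) * (V₂ᴴ * Gᴴ * Qᴴ * T * V₁ᴴ)ᴴ
        = V₂ᴴ * ((Gᴴ * Qᴴ * (T * (V₁ᴴ * V₁) * B) * (V₁ᴴ * V₁) * T * Q * G) * V₂) := by
      simp only [Matrix.conjTranspose_mul, Matrix.conjTranspose_conjTranspose, hTH,
        Matrix.mul_assoc]
    rw [this, hV₁, Matrix.trace_mul_comm, Matrix.mul_assoc _ V₂, hV₂', Matrix.mul_one,
      Matrix.mul_one, Matrix.mul_one, hTB, Matrix.mul_one]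
  have hX3 : Gᴴ * S⁻¹ * (S - S * Qᴴ * T * Q * S) * S⁻¹ * G
      = Gᴴ * S⁻¹ * G - Gᴴ * Qᴴ * T * Q * G := by
    have e1 : Gᴴ * S⁻¹ * (S * Qᴴ * T * Q * S) * S⁻¹ * G
        = Gᴴ * (S⁻¹ * S) * Qᴴ * T * Q * (S * S⁻¹) * G := by simp only [Matrix.mul_assoc]
    have e2 : Gᴴ * S⁻¹ * S * S⁻¹ * G = Gᴴ * (S⁻¹ * S) * S⁻¹ * G := by
      simp only [Matrix.mul_assoc]
    rw [Matrix.mul_sub, Matrix.sub_mul, Matrix.sub_mul, e1, e2, hSS, hSS', Matrix.mul_one,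
      Matrix.mul_one]
  rw [← Matrix.conjTranspose_mul _ (V₁ * Q * G * V₂), Matrix.trace_conjTranspose, hX1, hX2, hW, hX3]
  simp only [Matrix.trace_sub, Complex.sub_re, Complex.star_def, Complex.conj_re]
  ring
end

section
/- Let n and k be positive integers, let U ∈ ℂ^{n×n} be Hermitian positive definite, let v ∈ ℂ^n, let P ∈ ℂ^{n×k}, and let σ > 0. Then the matrix U + σ^{-2} v vᴴ is Hermitian positive definite (hence invertible), the scalar σ² + vᴴ U^{-1} v is a positive real number, and the following trace identity holds: Re tr(Pᴴ (U + σ^{-2} v vᴴ)^{-1} P) = Re tr(Pᴴ U^{-1} P) − (vᴴ U^{-1} P Pᴴ U^{-1} v) / (σ² + vᴴ U^{-1} v), where vᴴ U^{-1} P Pᴴ U^{-1} v is a nonnegative real number. -/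
open Matrix
open scoped ComplexOrder

/-- The Sherman–Morrison trace identity (equation (7) of the paper): for `U` Hermitian
positive definite, `v ∈ ℂⁿ`, `P ∈ ℂ^{n×k}` and `σ > 0`, the matrix `U + σ⁻² v vᴴ` is
Hermitian positive definite, the scalar `σ² + vᴴ U⁻¹ v` is a positive real, the scalar
`vᴴ U⁻¹ P Pᴴ U⁻¹ v` is a nonnegative real, and
`Re tr(Pᴴ (U + σ⁻² v vᴴ)⁻¹ P) = Re tr(Pᴴ U⁻¹ P) − (vᴴU⁻¹PPᴴU⁻¹v)/(σ² + vᴴU⁻¹v)`. -/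
theorem stmt5 (n k : ℕ) (hn : 0 < n) (hk : 0 < k)
    (U : Matrix (Fin n) (Fin n) ℂ) (hU : U.PosDef)
    (v : Fin n → ℂ) (P : Matrix (Fin n) (Fin k) ℂ)
    (σ : ℝ) (hσ : 0 < σ) :
    (U + ((σ : ℂ) ^ 2)⁻¹ • Matrix.vecMulVec v (star v)).PosDef ∧
    (((σ : ℂ) ^ 2 + star v ⬝ᵥ (U⁻¹ *ᵥ v)).im = 0 ∧
      0 < ((σ : ℂ) ^ 2 + star v ⬝ᵥ (U⁻¹ *ᵥ v)).re) ∧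
    ((star v ⬝ᵥ ((U⁻¹ * P * Pᴴ * U⁻¹) *ᵥ v)).im = 0 ∧
      0 ≤ (star v ⬝ᵥ ((U⁻¹ * P * Pᴴ * U⁻¹) *ᵥ v)).re) ∧
    (Matrix.trace (Pᴴ * (U + ((σ : ℂ) ^ 2)⁻¹ • Matrix.vecMulVec v (star v))⁻¹ * P)).re
      = (Matrix.trace (Pᴴ * U⁻¹ * P)).re
        - (star v ⬝ᵥ ((U⁻¹ * P * Pᴴ * U⁻¹) *ᵥ v)).re
          / ((σ : ℂ) ^ 2 + star v ⬝ᵥ (U⁻¹ *ᵥ v)).re := by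
  have hs : (0 : ℂ) < (σ : ℂ) ^ 2 := by
    have : (0 : ℂ) < (σ : ℂ) := by exact_mod_cast hσ
    exact pow_pos this 2
  have hV : (U⁻¹).PosDef := hU.inv
  have ha : 0 ≤ star v ⬝ᵥ (U⁻¹ *ᵥ v) := hV.posSemidef.dotProduct_mulVec_nonneg v
  have hd : 0 < (σ : ℂ) ^ 2 + star v ⬝ᵥ (U⁻¹ *ᵥ v) := add_pos_of_pos_of_nonneg hs ha
  have hPP : (U⁻¹ * P * Pᴴ * U⁻¹).PosSemidef := by
    have h := posSemidef_self_mul_conjTranspose (U⁻¹ * P)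
    rwa [conjTranspose_mul, hV.isHermitian.eq, ← Matrix.mul_assoc] at h
  have hb : 0 ≤ star v ⬝ᵥ ((U⁻¹ * P * Pᴴ * U⁻¹) *ᵥ v) := hPP.dotProduct_mulVec_nonneg v
  have hM : (U + ((σ : ℂ) ^ 2)⁻¹ • Matrix.vecMulVec v (star v)).PosDef :=
    hU.add_posSemidef ((posSemidef_vecMulVec_self_star v).smul (inv_nonneg.mpr hs.le))
  have hUV : U * U⁻¹ = 1 := Matrix.mul_nonsing_inv U ((Matrix.isUnit_iff_isUnit_det U).mp hU.isUnit)
  have hWVW : vecMulVec v (star v) * U⁻¹ * vecMulVec v (star v)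
      = (star v ⬝ᵥ (U⁻¹ *ᵥ v)) • vecMulVec v (star v) := by
    rw [Matrix.mul_assoc, mul_vecMulVec, vecMulVec_mul_vecMulVec, vecMulVec_smul]
  have htr : Matrix.trace (Pᴴ * (U⁻¹ * vecMulVec v (star v) * U⁻¹) * P)
      = star v ⬝ᵥ ((U⁻¹ * P * Pᴴ * U⁻¹) *ᵥ v) := by
    have h1 : Pᴴ * (U⁻¹ * vecMulVec v (star v) * U⁻¹) * P
        = (Pᴴ * U⁻¹ * vecMulVec v (star v)) * (U⁻¹ * P) := by
      simp only [Matrix.mul_assoc]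
    rw [h1, Matrix.trace_mul_comm]
    have h2 : U⁻¹ * P * (Pᴴ * U⁻¹ * vecMulVec v (star v))
        = (U⁻¹ * P * Pᴴ * U⁻¹) * vecMulVec v (star v) := by
      simp only [Matrix.mul_assoc]
    rw [h2, mul_vecMulVec, trace_vecMulVec, dotProduct_comm]
  generalize hA : star v ⬝ᵥ (U⁻¹ *ᵥ v) = a at *
  generalize hB : star v ⬝ᵥ ((U⁻¹ * P * Pᴴ * U⁻¹) *ᵥ v) = b at *
  generalize hW : vecMulVec v (star v) = W at *
  generalize hS : (σ : ℂ) ^ 2 = s at *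
  have hinv : (U + s⁻¹ • W)⁻¹ = U⁻¹ - (s + a)⁻¹ • (U⁻¹ * W * U⁻¹) := by
    apply Matrix.inv_eq_right_inv
    have e1 : U * (U⁻¹ * W * U⁻¹) = W * U⁻¹ := by
      rw [← Matrix.mul_assoc, ← Matrix.mul_assoc, hUV, Matrix.one_mul]
    have e2 : W * (U⁻¹ * W * U⁻¹) = a • (W * U⁻¹) := by
      rw [← Matrix.mul_assoc, ← Matrix.mul_assoc, hWVW, Matrix.smul_mul]
    rw [Matrix.add_mul, Matrix.mul_sub, Matrix.mul_sub, hUV, Matrix.mul_smul, e1,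
      Matrix.smul_mul, Matrix.smul_mul, Matrix.mul_smul, e2]
    have hs0 := hs.ne'
    have hd0 := hd.ne'
    have hc : s⁻¹ - (s + a)⁻¹ - s⁻¹ * ((s + a)⁻¹ * a) = 0 := by
      field_simp
      ring
    have : (1 : Matrix (Fin n) (Fin n) ℂ) - (s + a)⁻¹ • (W * U⁻¹)
        + (s⁻¹ • (W * U⁻¹) - s⁻¹ • (s + a)⁻¹ • a • (W * U⁻¹))
        = 1 + (s⁻¹ - (s + a)⁻¹ - s⁻¹ * ((s + a)⁻¹ * a)) • (W * U⁻¹) := by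
      module
    rw [this, hc, zero_smul, add_zero]
  obtain ⟨hd1, hd2⟩ := Complex.lt_def.mp hd
  obtain ⟨hb1, hb2⟩ := Complex.le_def.mp hb
  refine ⟨hM, ⟨hd2.symm, hd1⟩, ⟨hb2.symm, hb1⟩, ?_⟩
  rw [hinv, Matrix.mul_sub, Matrix.sub_mul, Matrix.trace_sub, Matrix.mul_smul, Matrix.smul_mul,
    Matrix.trace_smul, htr, Complex.sub_re]
  congr 1
  have hdr : s + a = (((s + a).re : ℝ) : ℂ) := Complex.ext rfl hd2.symm
  have hd3 : ((s + a)⁻¹ • b).re = b.re / (s + a).re := by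
    rw [hdr, smul_eq_mul, ← Complex.ofReal_inv, Complex.re_ofReal_mul, Complex.ofReal_re]
    ring
  exact hd3
end
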